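/- arXiv:1510.05035 — 4 statements merged into one kernel-verified Lean document; each statement's English description precedes it below -/
import Mathlib

section
/- Let ρ₀ be a density matrix on ℂ^m ⊗ ℂ^n and let U : ℝ → Matrix (Fin m × Fin n) (Fin m × Fin n) ℂ be a continuous family of unitary matrices with U(0) = 1, and set ρ(t) = U(t) ρ₀ U(t)†. Suppose that for every t ∈ ℝ there exist a complete family of pairwise orthogonal rank-one projections {P_j(t)}_{j=1}^m on ℂ^m, a complete family of pairwise orthogonal rank-one projections {Q_k(t)}_{k=1}^n on ℂ^n, and nonnegative reals p_{jk}(t), such that ρ(t) = Σ_{j,k} p_{jk}(t) · P_j(t) ⊗ₖ Q_k(t) (i.e., the state has zero two-way discord at all times). Then for every t ∈ ℝ there exist unitary matrices V_A(t) on ℂ^m and V_B(t) on ℂ^n such that ρ(t) = (V_A(t) ⊗ₖ V_B(t)) ρ₀ (V_A(t) ⊗ₖ V_B(t))†; that is, the evolution of ρ is indistinguishable from a non-interacting (product unitary) evolution. -/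
open Matrix Kronecker
open scoped ComplexOrder

/-- A density matrix: Hermitian positive semidefinite with trace 1. -/
def IsDensityMatrix {d : Type*} [Fintype d] (ρ : Matrix d d ℂ) : Prop :=
  ρ.PosSemidef ∧ ρ.trace = 1

/-- A complete family of pairwise orthogonal rank-one projections on ℂ^d. -/
def IsRankOneProjFamily {d : ℕ} (P : Fin d → Matrix (Fin d) (Fin d) ℂ) : Prop :=
  (∀ j, (P j).IsHermitian) ∧
  (∀ j l, P j * P l = if j = l then P j else 0) ∧
  (∀ j, (P j).rank = 1) ∧
  (∑ j, P j = 1)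

namespace NoDiscordAux

/-- Local unitary equivalence of bipartite matrices. -/
def R {m n : ℕ} (M N : Matrix (Fin m × Fin n) (Fin m × Fin n) ℂ) : Prop :=
  ∃ (VA : Matrix (Fin m) (Fin m) ℂ) (VB : Matrix (Fin n) (Fin n) ℂ),
      VA ∈ Matrix.unitaryGroup (Fin m) ℂ ∧ VB ∈ Matrix.unitaryGroup (Fin n) ℂ ∧
      M = (VA ⊗ₖ VB) * N * (VA ⊗ₖ VB)ᴴ

lemma kron_left {m n : ℕ} {VA : Matrix (Fin m) (Fin m) ℂ} {VB : Matrix (Fin n) (Fin n) ℂ}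
    (hA : VA ∈ Matrix.unitaryGroup (Fin m) ℂ) (hB : VB ∈ Matrix.unitaryGroup (Fin n) ℂ) :
    (VA ⊗ₖ VB)ᴴ * (VA ⊗ₖ VB) = 1 := by
  rw [Matrix.mem_unitaryGroup_iff'] at hA hB
  rw [conjTranspose_kronecker, ← mul_kronecker_mul]
  rw [star_eq_conjTranspose] at hA hB
  rw [hA, hB, one_kronecker_one]

lemma R.symm {m n : ℕ} {M N : Matrix (Fin m × Fin n) (Fin m × Fin n) ℂ} (h : R M N) : R N M := by
  obtain ⟨VA, VB, hA, hB, rfl⟩ := h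
  have hk := kron_left hA hB
  refine ⟨star VA, star VB, Unitary.star_mem hA, Unitary.star_mem hB, ?_⟩
  have e : (star VA) ⊗ₖ (star VB) = (VA ⊗ₖ VB)ᴴ := by
    rw [conjTranspose_kronecker]; rfl
  rw [e, conjTranspose_conjTranspose]
  generalize VA ⊗ₖ VB = W at *
  calc N = (Wᴴ * W) * N * (Wᴴ * W) := by rw [hk]; simp
    _ = _ := by simp only [Matrix.mul_assoc]

lemma R.trans {m n : ℕ} {M N K : Matrix (Fin m × Fin n) (Fin m × Fin n) ℂ}
    (h : R M N) (h' : R N K) : R M K := by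
  obtain ⟨VA, VB, hA, hB, rfl⟩ := h
  obtain ⟨WA, WB, hA', hB', rfl⟩ := h'
  refine ⟨VA * WA, VB * WB, mul_mem hA hA', mul_mem hB hB', ?_⟩
  rw [mul_kronecker_mul, conjTranspose_mul]
  simp only [Matrix.mul_assoc]

lemma compact_unitary (d : ℕ) :
    IsCompact {V : Matrix (Fin d) (Fin d) ℂ | V ∈ Matrix.unitaryGroup (Fin d) ℂ} := by
  have hK : IsCompact (Set.univ.pi fun _ : Fin d => Set.univ.pi fun _ : Fin d =>
      Metric.closedBall (0 : ℂ) 1) :=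
    isCompact_univ_pi fun _ => isCompact_univ_pi fun _ => isCompact_closedBall _ _
  refine IsCompact.of_isClosed_subset (s := (Set.univ.pi fun _ : Fin d => Set.univ.pi fun _ : Fin d =>
      Metric.closedBall (0 : ℂ) 1 : Set (Matrix (Fin d) (Fin d) ℂ))) hK ?_ ?_
  · simp only [Matrix.mem_unitaryGroup_iff]
    exact isClosed_eq (by fun_prop) continuous_const
  · intro V hV i _ j _
    simpa using entry_norm_bound_of_unitary hV i j

lemma closed_orbit {m n : ℕ} (N : Matrix (Fin m × Fin n) (Fin m × Fin n) ℂ) :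
    IsClosed {M | R M N} := by
  have hc := ((compact_unitary m).prod (compact_unitary n)).image
    (f := fun V : Matrix (Fin m) (Fin m) ℂ × Matrix (Fin n) (Fin n) ℂ =>
      (V.1 ⊗ₖ V.2) * N * (V.1 ⊗ₖ V.2)ᴴ) (by
      have h : Continuous fun V : Matrix (Fin m) (Fin m) ℂ × Matrix (Fin n) (Fin n) ℂ =>
          V.1 ⊗ₖ V.2 := by
        refine continuous_matrix fun i j => ?_
        simp only [kroneckerMap_apply]
        exact (continuous_fst.matrix_elem _ _).mul (continuous_snd.matrix_elem _ _)
      exact (h.matrix_mul continuous_const).matrix_mul h.matrix_conjTranspose)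
  convert hc.isClosed using 1
  ext M
  constructor
  · rintro ⟨VA, VB, hA, hB, rfl⟩
    exact ⟨(VA, VB), ⟨hA, hB⟩, rfl⟩
  · rintro ⟨⟨VA, VB⟩, ⟨hA, hB⟩, rfl⟩
    exact ⟨VA, VB, hA, hB, rfl⟩

lemma family_unitary {d : ℕ} {P : Fin d → Matrix (Fin d) (Fin d) ℂ} (hP : IsRankOneProjFamily P) :
    ∃ V ∈ Matrix.unitaryGroup (Fin d) ℂ, ∀ j, P j = V * Matrix.single j j 1 * Vᴴ := by
  obtain ⟨hH, hM, hR, -⟩ := hP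
  have h1 : ∀ j, ∃ u : Fin d → ℂ, P j *ᵥ u = u ∧ star u ⬝ᵥ u = 1 := by
    intro j
    have hne : P j ≠ 0 := by
      intro h
      have := hR j
      rw [h] at this
      simp at this
    obtain ⟨v, hv⟩ : ∃ v, P j *ᵥ v ≠ 0 := by
      by_contra! h
      apply hne
      ext a b
      have := congrFun (h (Pi.single b 1)) a
      simpa using this
    set w := P j *ᵥ v with hw
    have hPw : P j *ᵥ w = w := by
      rw [hw, mulVec_mulVec, hM]; simp
    have hpos : 0 < star w ⬝ᵥ w := dotProduct_star_self_pos_iff.mpr hv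
    obtain ⟨r, hr⟩ : ∃ r : ℝ, star w ⬝ᵥ w = r := by
      refine ⟨(star w ⬝ᵥ w).re, ?_⟩
      exact Complex.eq_re_of_ofReal_le (r := 0) (by simpa using hpos.le)
    have hr0 : 0 < r := by rw [hr] at hpos; exact_mod_cast hpos
    refine ⟨((Real.sqrt r)⁻¹ : ℂ) • w, ?_, ?_⟩
    · rw [mulVec_smul, hPw]
    · rw [star_smul, smul_dotProduct, dotProduct_smul, hr]
      have h2 : ((Real.sqrt r : ℝ) : ℂ) * (Real.sqrt r : ℝ) = r := by
        rw [← Complex.ofReal_mul, Real.mul_self_sqrt hr0.le]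
      have h3 : ((Real.sqrt r : ℝ) : ℂ) ≠ 0 := by
        exact_mod_cast (Real.sqrt_pos.mpr hr0).ne'
      simp only [star_inv₀, smul_eq_mul, Complex.star_def, Complex.conj_ofReal]
      rw [← h2]
      field_simp
  choose u hu hn using h1
  have hPu : ∀ j k, P j *ᵥ u k = if j = k then u k else 0 := by
    intro j k
    rw [← hu k, mulVec_mulVec, hM]
    split_ifs with h
    · rw [h, hu k]
    · simp
  let V : Matrix (Fin d) (Fin d) ℂ := Matrix.of fun a j => u j a
  have hV : V ∈ Matrix.unitaryGroup (Fin d) ℂ := by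
    rw [Matrix.mem_unitaryGroup_iff']
    ext j k
    have e : (star V * V) j k = star (u j) ⬝ᵥ u k := by
      simp [V, Matrix.mul_apply, dotProduct, star_apply]
    rw [e]
    by_cases h : j = k
    · subst h; simp [hn]
    · rw [one_apply_ne h, ← hu j, star_mulVec, ← dotProduct_mulVec, (hH j).eq, hPu]
      simp [h]
  refine ⟨V, hV, fun j => ?_⟩
  have hc : P j * V = V * Matrix.single j j 1 := by
    ext a k
    have e : (P j * V) a k = (P j *ᵥ u k) a := by
      simp [V, Matrix.mul_apply, mulVec, dotProduct]
    rw [e, hPu]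
    by_cases h : j = k
    · subst h; simp [V]
    · simp [h, Matrix.mul_single_apply_of_ne, Ne.symm h]
  rw [← hc, Matrix.mul_assoc, ← star_eq_conjTranspose, (Matrix.mem_unitaryGroup_iff).1 hV, Matrix.mul_one]

lemma R_diag {m n : ℕ} {P : Fin m → Matrix (Fin m) (Fin m) ℂ}
    {Q : Fin n → Matrix (Fin n) (Fin n) ℂ} (p : Fin m → Fin n → ℝ)
    (hP : IsRankOneProjFamily P) (hQ : IsRankOneProjFamily Q) :
    R (∑ j, ∑ k, (p j k : ℂ) • (P j ⊗ₖ Q k)) (diagonal fun x => (p x.1 x.2 : ℂ)) := by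
  obtain ⟨V, hV, hPV⟩ := family_unitary hP
  obtain ⟨W, hW, hQW⟩ := family_unitary hQ
  refine ⟨V, W, hV, hW, ?_⟩
  have hd : (diagonal fun x : Fin m × Fin n => (p x.1 x.2 : ℂ)) =
      ∑ j, ∑ k, (p j k : ℂ) • (Matrix.single j j (1:ℂ) ⊗ₖ Matrix.single k k (1:ℂ)) := by
    rw [← Fintype.sum_prod_type' (f := fun j k => (p j k : ℂ) • (Matrix.single j j (1:ℂ) ⊗ₖ Matrix.single k k (1:ℂ)))]
    simp only [single_kronecker_single, smul_single]
    rw [← Matrix.sum_single_eq_diagonal]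
    simp
  rw [hd]
  simp only [Matrix.mul_sum, Matrix.sum_mul, Matrix.mul_smul, Matrix.smul_mul,
    conjTranspose_kronecker, ← mul_kronecker_mul, ← hPV, ← hQW]

end NoDiscordAux

open NoDiscordAux in
/-- If a continuously (and unitarily) evolving bipartite state has zero two-way discord
(i.e. is diagonal in a product basis) at all times, then its evolution is indistinguishable
from a non-interacting product-unitary evolution. -/
theorem no_discord_implies_product_evolution {m n : ℕ}
    (ρ₀ : Matrix (Fin m × Fin n) (Fin m × Fin n) ℂ)
    (hρ₀ : IsDensityMatrix ρ₀)
    (U : ℝ → Matrix (Fin m × Fin n) (Fin m × Fin n) ℂ)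
    (hUcont : ∀ p q, Continuous fun t => U t p q)
    (hUunit : ∀ t, U t ∈ Matrix.unitaryGroup (Fin m × Fin n) ℂ)
    (hU0 : U 0 = 1)
    (ρ : ℝ → Matrix (Fin m × Fin n) (Fin m × Fin n) ℂ)
    (hρ : ∀ t, ρ t = U t * ρ₀ * (U t)ᴴ)
    (hdiscord : ∀ t : ℝ, ∃ (P : Fin m → Matrix (Fin m) (Fin m) ℂ)
      (Q : Fin n → Matrix (Fin n) (Fin n) ℂ) (p : Fin m → Fin n → ℝ),
      IsRankOneProjFamily P ∧ IsRankOneProjFamily Q ∧ (∀ j k, 0 ≤ p j k) ∧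
      ρ t = ∑ j, ∑ k, (p j k : ℂ) • (P j ⊗ₖ Q k)) :
    ∀ t : ℝ, ∃ (VA : Matrix (Fin m) (Fin m) ℂ) (VB : Matrix (Fin n) (Fin n) ℂ),
      VA ∈ Matrix.unitaryGroup (Fin m) ℂ ∧ VB ∈ Matrix.unitaryGroup (Fin n) ℂ ∧
      ρ t = (VA ⊗ₖ VB) * ρ₀ * (VA ⊗ₖ VB)ᴴ := by

  set F : Set (Fin m × Fin n → ℂ) := {q | ∀ x, q x ∈ ρ₀.charpoly.roots.toFinset} with hF
  have hFfin : F.Finite := Set.Finite.pi' fun _ => Finset.finite_toSet _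
  have hcover : ∀ t, ∃ q ∈ F, R (ρ t) (diagonal q) := by
    intro t
    obtain ⟨P, Q, p, hP, hQ, -, he⟩ := hdiscord t
    have hR := R_diag p hP hQ
    rw [← he] at hR
    refine ⟨_, ?_, hR⟩
    obtain ⟨VA, VB, hA, hB, h⟩ := hR
    have hk := kron_left hA hB
    have h1 : (ρ t).charpoly = (diagonal fun x : Fin m × Fin n => (p x.1 x.2 : ℂ)).charpoly := by
      rw [h, Matrix.charpoly_mul_comm, ← Matrix.mul_assoc, hk, Matrix.one_mul]
    have h2 : (ρ t).charpoly = ρ₀.charpoly := by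
      have hu := (Matrix.mem_unitaryGroup_iff').1 (hUunit t)
      rw [star_eq_conjTranspose] at hu
      rw [hρ, Matrix.charpoly_mul_comm, ← Matrix.mul_assoc, hu, Matrix.one_mul]
    intro x
    rw [← h2, h1, Multiset.mem_toFinset, Polynomial.mem_roots (Matrix.charpoly_monic _).ne_zero,
      Matrix.charpoly_diagonal, Polynomial.IsRoot.def, Polynomial.eval_prod]
    exact Finset.prod_eq_zero (Finset.mem_univ x) (by simp)
  have hUc : Continuous U := continuous_matrix hUcont
  have hρc : Continuous ρ := by
    rw [show ρ = fun t => U t * ρ₀ * (U t)ᴴ from funext hρ]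
    exact (hUc.matrix_mul continuous_const).matrix_mul hUc.matrix_conjTranspose
  have hcl : ∀ N, IsClosed {s | R (ρ s) N} := fun N => (closed_orbit N).preimage hρc
  have hcompl : {s | R (ρ s) ρ₀}ᶜ =
      ⋃ q ∈ {q ∈ F | ¬ R (diagonal q) ρ₀}, {s | R (ρ s) (diagonal q)} := by
    ext s
    simp only [Set.mem_compl_iff, Set.mem_setOf_eq, Set.mem_iUnion, exists_prop]
    constructor
    · intro hs
      obtain ⟨q, hq, hR⟩ := hcover s
      exact ⟨q, ⟨hq, fun h => hs (hR.trans h)⟩, hR⟩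
    · rintro ⟨q, ⟨_, hq⟩, hR⟩ hs
      exact hq (hR.symm.trans hs)
  have hopen : IsOpen {s | R (ρ s) ρ₀} := by
    rw [← isClosed_compl_iff, hcompl]
    exact (hFfin.subset (Set.sep_subset _ _)).isClosed_biUnion fun q _ => hcl _
  have hclopen : IsClopen {s | R (ρ s) ρ₀} := ⟨hcl _, hopen⟩
  have huniv := hclopen.eq_univ ⟨0, by
    refine ⟨1, 1, one_mem _, one_mem _, ?_⟩
    simp [hρ, hU0]⟩
  intro t
  have : t ∈ {s | R (ρ s) ρ₀} := huniv ▸ Set.mem_univ t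
  exact this
end

section
/- Let ρ₀ be a density matrix on ℂ^m ⊗ ℂ^n and let U : ℝ → Matrix (Fin m × Fin n) (Fin m × Fin n) ℂ be a continuous family of unitary matrices with U(0) = 1, and set ρ(t) = U(t) ρ₀ U(t)†. Suppose that for every t ∈ ℝ there exist complete families of pairwise orthogonal rank-one projections {P_j(t)} on ℂ^m and {Q_k(t)} on ℂ^n and nonnegative reals p_{jk}(t) with ρ(t) = Σ_{j,k} p_{jk}(t) · P_j(t) ⊗ₖ Q_k(t). Then for every t ∈ ℝ there exist unitaries V_A(t) on ℂ^m and V_B(t) on ℂ^n such that the reduced states satisfy Tr_B ρ(t) = V_A(t) (Tr_B ρ₀) V_A(t)† and Tr_A ρ(t) = V_B(t) (Tr_A ρ₀) V_B(t)†; in particular the von Neumann entropies S(Tr_A ρ(t)) and S(Tr_B ρ(t)) are constant in t (the marginals evolve unitarily, so no heat is transferred). -/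
open Matrix Kronecker
open scoped ComplexOrder

/-- Partial trace over the second (B) factor. -/
noncomputable def ptraceB {m n : ℕ} (M : Matrix (Fin m × Fin n) (Fin m × Fin n) ℂ) :
    Matrix (Fin m) (Fin m) ℂ := Matrix.of fun i i' => ∑ k, M (i, k) (i', k)

/-- Partial trace over the first (A) factor. -/
noncomputable def ptraceA {m n : ℕ} (M : Matrix (Fin m × Fin n) (Fin m × Fin n) ℂ) :
    Matrix (Fin n) (Fin n) ℂ := Matrix.of fun k k' => ∑ i, M (i, k) (i, k')

/-- Von Neumann entropy `S(ρ) = -∑ λᵢ log λᵢ` over the eigenvalues of a Hermitian matrix. -/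
noncomputable def vNEntropy {d : ℕ} (ρ : Matrix (Fin d) (Fin d) ℂ) : ℝ :=
  if h : ρ.IsHermitian then -∑ i, h.eigenvalues i * Real.log (h.eigenvalues i) else 0

lemma aux_trace {d : ℕ} {P : Fin d → Matrix (Fin d) (Fin d) ℂ} (h : IsRankOneProjFamily P)
    (j : Fin d) : (P j).trace = 1 := by
  have h1 : P j * P j = P j := by simpa using h.2.1 j j
  have h2 : IsIdempotentElem (Matrix.toLin' (P j)) := by
    unfold IsIdempotentElem
    rw [Module.End.mul_eq_comp, ← Matrix.toLin'_mul, h1]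
  have h3 := (LinearMap.IsIdempotentElem.isProj_range _ h2).trace
  rw [Matrix.trace_toLin'_eq] at h3
  rw [h3]
  have h4 := h.2.2.1 j
  rw [Matrix.rank_eq_finrank_range_toLin (P j) (Pi.basisFun ℂ (Fin d)) (Pi.basisFun ℂ (Fin d)),
    Matrix.toLin_eq_toLin'] at h4
  rw [h4]; simp

lemma aux_mul {d : ℕ} {P : Fin d → Matrix (Fin d) (Fin d) ℂ} (h : IsRankOneProjFamily P)
    (a : Fin d → ℂ) (j : Fin d) : P j * (∑ l, a l • P l) = a j • P j := by
  simp [Finset.mul_sum, h.2.1]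

lemma aux_eig {d : ℕ} {P : Fin d → Matrix (Fin d) (Fin d) ℂ} (h : IsRankOneProjFamily P)
    (a : Fin d → ℂ) (v : Fin d → ℂ) (hv : v ≠ 0) (z : ℂ)
    (hz : (∑ l, a l • P l) *ᵥ v = z • v) : ∃ j, z = a j := by
  by_contra! hne
  apply hv
  have h0 : ∀ j, P j *ᵥ v = 0 := by
    intro j
    have e : P j *ᵥ ((∑ l, a l • P l) *ᵥ v) = P j *ᵥ (z • v) := by rw [hz]
    rw [Matrix.mulVec_mulVec, aux_mul h, Matrix.smul_mulVec, Matrix.mulVec_smul] at e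
    have e2 : (z - a j) • (P j *ᵥ v) = 0 := by rw [sub_smul, e, sub_self]
    exact (smul_eq_zero.mp e2).resolve_left (sub_ne_zero.mpr (hne j))
  have : (∑ j, P j) *ᵥ v = 0 := by
    rw [Matrix.sum_mulVec]; simp [h0]
  rwa [h.2.2.2, Matrix.one_mulVec] at this

lemma aux_main {d : ℕ} (A : ℝ → Matrix (Fin d) (Fin d) ℂ) (hA : ∀ t, (A t).IsHermitian)
    (hc : Continuous A) (F : Set ℂ) (hF : F.Finite)
    (h : ∀ t, ∃ (P : Fin d → Matrix (Fin d) (Fin d) ℂ) (a : Fin d → ℂ),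
      IsRankOneProjFamily P ∧ (∀ j, a j ∈ F) ∧ A t = ∑ j, a j • P j) (t : ℝ) :
    (∃ V ∈ Matrix.unitaryGroup (Fin d) ℂ, A t = V * A 0 * Vᴴ) ∧
      vNEntropy (A t) = vNEntropy (A 0) := by
  have hmem : ∀ t i, ((hA t).eigenvalues i : ℂ) ∈ F := by
    intro t i
    obtain ⟨P, a, hP, ha, hAt⟩ := h t
    have e := (hA t).mulVec_eigenvectorBasis i
    have hv : (⇑((hA t).eigenvectorBasis i) : Fin d → ℂ) ≠ 0 :=
      (WithLp.ofLp_eq_zero 2).ne.2 <| (hA t).eigenvectorBasis.orthonormal.ne_zero i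
    obtain ⟨j, hj⟩ := aux_eig hP a _ hv ((hA t).eigenvalues i : ℂ) (by
      rw [← hAt, e]; ext k; simp)
    rw [hj]; exact ha j
  have hchar : (A t).charpoly = (A 0).charpoly := by
    apply Polynomial.funext
    intro z
    have hfin : ((fun f : Fin d → ℂ => ∏ i, (z - f i)) '' {f | ∀ i, f i ∈ F}).Finite :=
      (Set.Finite.pi' fun _ => hF).image _
    have hcont : Continuous fun t => (A t).charpoly.eval z := by
      simp only [Matrix.eval_charpoly]
      exact (continuous_const.sub hc).matrix_det
    refine isPreconnected_univ.constant_of_mapsTo hfin.isDiscrete hcont.continuousOn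
      ?_ (Set.mem_univ t) (Set.mem_univ 0)
    intro s _
    refine ⟨fun i => ((hA s).eigenvalues i : ℂ), hmem s, ?_⟩
    simp [(hA s).charpoly_eq, Polynomial.eval_prod]
  have heig := ((hA t).eigenvalues_eq_eigenvalues_iff (hA 0)).2 hchar
  constructor
  · set W := (hA t).eigenvectorUnitary
    set W0 := (hA 0).eigenvectorUnitary
    refine ⟨(W * star W0 : Matrix.unitaryGroup (Fin d) ℂ), Subtype.property _, ?_⟩
    have e1 := (hA t).spectral_theorem
    have e0 := (hA 0).spectral_theorem
    rw [Unitary.conjStarAlgAut_apply] at e1 e0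
    rw [heig] at e1
    have hu : star (W0 : Matrix (Fin d) (Fin d) ℂ) * W0 = 1 := Unitary.coe_star_mul_self W0
    conv_lhs => rw [e1]
    conv_rhs => rw [e0]
    change _ = ((W : Matrix (Fin d) (Fin d) ℂ) * star (W0 : Matrix (Fin d) (Fin d) ℂ)) *
      ((W0 : Matrix (Fin d) (Fin d) ℂ) * diagonal (RCLike.ofReal ∘ (hA 0).eigenvalues) * star (W0 : Matrix (Fin d) (Fin d) ℂ)) *
      star ((W : Matrix (Fin d) (Fin d) ℂ) * star (W0 : Matrix (Fin d) (Fin d) ℂ))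
    rw [star_mul, star_star]
    generalize diagonal ((RCLike.ofReal : ℝ → ℂ) ∘ (hA 0).eigenvalues) = D
    calc _ = (W : Matrix (Fin d) (Fin d) ℂ) * (star (W0 : Matrix (Fin d) (Fin d) ℂ) * W0) * D *
        (star (W0 : Matrix (Fin d) (Fin d) ℂ) * W0) * star (W : Matrix (Fin d) (Fin d) ℂ) := by
          rw [hu]; simp [W]
      _ = _ := by simp only [mul_assoc]
  · unfold vNEntropy
    rw [dif_pos (hA t), dif_pos (hA 0), heig]

lemma aux_root {m n : ℕ} {P : Fin m → Matrix (Fin m) (Fin m) ℂ}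
    {Q : Fin n → Matrix (Fin n) (Fin n) ℂ} (hP : IsRankOneProjFamily P)
    (hQ : IsRankOneProjFamily Q) (p : Fin m → Fin n → ℝ) (j : Fin m) (k : Fin n) :
    (∑ j, ∑ k, (p j k : ℂ) • (P j ⊗ₖ Q k)).charpoly.IsRoot (p j k : ℂ) := by
  have hM : P j ⊗ₖ Q k ≠ 0 := by
    intro h0
    have := Matrix.trace_kronecker (P j) (Q k)
    rw [h0, aux_trace hP, aux_trace hQ] at this
    simp at this
  have hmul : (∑ j, ∑ k, (p j k : ℂ) • (P j ⊗ₖ Q k)) * (P j ⊗ₖ Q k)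
      = (p j k : ℂ) • (P j ⊗ₖ Q k) := by
    simp only [Finset.sum_mul, smul_mul_assoc, ← Matrix.mul_kronecker_mul, hP.2.1, hQ.2.1]
    rw [Finset.sum_eq_single j, Finset.sum_eq_single k]
    · simp
    · intro b _ hb; simp [hb]
    · simp
    · intro b _ hb; simp [hb]
    · simp
  rw [Polynomial.IsRoot, Matrix.eval_charpoly]
  by_contra hdet
  have hu := (Matrix.isUnit_iff_isUnit_det _).2 (isUnit_iff_ne_zero.2 hdet)
  apply hM
  refine hu.mul_right_eq_zero.1 ?_
  rw [sub_mul, hmul, Matrix.scalar_apply, ← Matrix.smul_eq_diagonal_mul]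
  ext; simp

lemma aux_ptB {m n : ℕ} {P : Fin m → Matrix (Fin m) (Fin m) ℂ}
    {Q : Fin n → Matrix (Fin n) (Fin n) ℂ} (hQ : IsRankOneProjFamily Q) (p : Fin m → Fin n → ℝ) :
    ptraceB (∑ j, ∑ k, (p j k : ℂ) • (P j ⊗ₖ Q k)) = ∑ j, (∑ k, (p j k : ℂ)) • P j := by
  ext i i'
  have ht : ∀ k, ∑ x, Q k x x = 1 := fun k => aux_trace hQ k
  simp only [ptraceB, Matrix.of_apply, Matrix.sum_apply, Matrix.smul_apply,
    Matrix.kroneckerMap_apply, smul_eq_mul]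
  rw [Finset.sum_comm]
  refine Finset.sum_congr rfl fun j _ => ?_
  rw [Finset.sum_comm, Finset.sum_mul]
  refine Finset.sum_congr rfl fun k _ => ?_
  rw [← Finset.mul_sum, ← Finset.mul_sum, ht, mul_one]

lemma aux_ptA {m n : ℕ} {P : Fin m → Matrix (Fin m) (Fin m) ℂ}
    {Q : Fin n → Matrix (Fin n) (Fin n) ℂ} (hP : IsRankOneProjFamily P) (p : Fin m → Fin n → ℝ) :
    ptraceA (∑ j, ∑ k, (p j k : ℂ) • (P j ⊗ₖ Q k)) = ∑ k, (∑ j, (p j k : ℂ)) • Q k := by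
  ext i i'
  have ht : ∀ k, ∑ x, P k x x = 1 := fun k => aux_trace hP k
  rw [Finset.sum_comm]
  simp only [ptraceA, Matrix.of_apply, Matrix.sum_apply, Matrix.smul_apply,
    Matrix.kroneckerMap_apply, smul_eq_mul]
  rw [Finset.sum_comm]
  refine Finset.sum_congr rfl fun j _ => ?_
  rw [Finset.sum_comm, Finset.sum_mul]
  refine Finset.sum_congr rfl fun k _ => ?_
  rw [← Finset.mul_sum, ← Finset.sum_mul, ht, one_mul]

/-- If a continuously (and unitarily) evolving bipartite state has zero two-way discord at all
times, then its marginals evolve unitarily; in particular their von Neumann entropies are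
constant and no heat is transferred. -/
theorem no_discord_implies_unitary_marginals {m n : ℕ}
    (ρ₀ : Matrix (Fin m × Fin n) (Fin m × Fin n) ℂ)
    (hρ₀ : IsDensityMatrix ρ₀)
    (U : ℝ → Matrix (Fin m × Fin n) (Fin m × Fin n) ℂ)
    (hUcont : ∀ p q, Continuous fun t => U t p q)
    (hUunit : ∀ t, U t ∈ Matrix.unitaryGroup (Fin m × Fin n) ℂ)
    (hU0 : U 0 = 1)
    (ρ : ℝ → Matrix (Fin m × Fin n) (Fin m × Fin n) ℂ)
    (hρ : ∀ t, ρ t = U t * ρ₀ * (U t)ᴴ)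
    (hdiscord : ∀ t : ℝ, ∃ (P : Fin m → Matrix (Fin m) (Fin m) ℂ)
      (Q : Fin n → Matrix (Fin n) (Fin n) ℂ) (p : Fin m → Fin n → ℝ),
      IsRankOneProjFamily P ∧ IsRankOneProjFamily Q ∧ (∀ j k, 0 ≤ p j k) ∧
      ρ t = ∑ j, ∑ k, (p j k : ℂ) • (P j ⊗ₖ Q k)) :
    (∀ t : ℝ, ∃ (VA : Matrix (Fin m) (Fin m) ℂ) (VB : Matrix (Fin n) (Fin n) ℂ),
      VA ∈ Matrix.unitaryGroup (Fin m) ℂ ∧ VB ∈ Matrix.unitaryGroup (Fin n) ℂ ∧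
      ptraceB (ρ t) = VA * ptraceB ρ₀ * VAᴴ ∧
      ptraceA (ρ t) = VB * ptraceA ρ₀ * VBᴴ) ∧
    (∀ t : ℝ, vNEntropy (ptraceB (ρ t)) = vNEntropy (ptraceB ρ₀)) ∧
    (∀ t : ℝ, vNEntropy (ptraceA (ρ t)) = vNEntropy (ptraceA ρ₀)) := by
  have hherm : ∀ t, (ρ t).IsHermitian := fun t => by
    rw [hρ]; exact Matrix.isHermitian_mul_mul_conjTranspose _ hρ₀.1.isHermitian
  have hUc : Continuous U := continuous_matrix hUcont
  have hρc : Continuous ρ := by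
    rw [funext hρ]
    exact (hUc.matrix_mul continuous_const).matrix_mul hUc.matrix_conjTranspose
  have hρ0 : ρ 0 = ρ₀ := by rw [hρ, hU0]; simp
  have hcp : ∀ t, (ρ t).charpoly = ρ₀.charpoly := fun t => by
    have hu : (U t)ᴴ * U t = 1 := Matrix.mem_unitaryGroup_iff'.1 (hUunit t)
    rw [hρ, Matrix.charpoly_mul_comm, ← mul_assoc, hu, one_mul]
  have hE : {z | ρ₀.charpoly.IsRoot z}.Finite :=
    Polynomial.finite_setOfPred_isRoot (Matrix.charpoly_monic _).ne_zero
  have hB := aux_main (fun t => ptraceB (ρ t))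
    (fun t => by
      ext i i'
      simp only [ptraceB, Matrix.conjTranspose_apply, Matrix.of_apply, star_sum]
      exact Finset.sum_congr rfl fun k _ => (hherm t).apply _ _)
    (continuous_matrix fun i i' => by
      simp only [ptraceB, Matrix.of_apply]
      exact continuous_finsetSum _ fun k _ => hρc.matrix_elem _ _)
    ((fun f : Fin n → ℂ => ∑ k, f k) '' {f | ∀ k, f k ∈ {z | ρ₀.charpoly.IsRoot z}})
    ((Set.Finite.pi' fun _ => hE).image _)
    (fun t => by
      obtain ⟨P, Q, p, hP, hQ, -, e⟩ := hdiscord t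
      refine ⟨P, fun j => ∑ k, (p j k : ℂ), hP, fun j => ⟨fun k => p j k, fun k => ?_, rfl⟩, ?_⟩
      · have := aux_root hP hQ p j k
        rwa [← e, hcp] at this
      · rw [e]; exact aux_ptB hQ p)
  have hA := aux_main (fun t => ptraceA (ρ t))
    (fun t => by
      ext i i'
      simp only [ptraceA, Matrix.conjTranspose_apply, Matrix.of_apply, star_sum]
      exact Finset.sum_congr rfl fun k _ => (hherm t).apply _ _)
    (continuous_matrix fun i i' => by
      simp only [ptraceA, Matrix.of_apply]
      exact continuous_finsetSum _ fun k _ => hρc.matrix_elem _ _)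
    ((fun f : Fin m → ℂ => ∑ k, f k) '' {f | ∀ k, f k ∈ {z | ρ₀.charpoly.IsRoot z}})
    ((Set.Finite.pi' fun _ => hE).image _)
    (fun t => by
      obtain ⟨P, Q, p, hP, hQ, -, e⟩ := hdiscord t
      refine ⟨Q, fun k => ∑ j, (p j k : ℂ), hQ, fun k => ⟨fun j => p j k, fun j => ?_, rfl⟩, ?_⟩
      · have := aux_root hP hQ p j k
        rwa [← e, hcp] at this
      · rw [e]; exact aux_ptA hP p)
  simp only [hρ0] at hA hB
  refine ⟨fun t => ?_, fun t => (hB t).2, fun t => (hA t).2⟩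
  obtain ⟨VA, h1, h2⟩ := (hB t).1
  obtain ⟨VB, h3, h4⟩ := (hA t).1
  exact ⟨VA, VB, h1, h3, h2, h4⟩
end

section
/- Let ρ be a density matrix on ℂ^m ⊗ ℂ^n and let {P_j}_{j=1}^m be a complete family of pairwise orthogonal rank-one projections on ℂ^m. If ρ is invariant under dephasing of the first factor in this family, i.e. Σ_j (P_j ⊗ₖ 1_n) ρ (P_j ⊗ₖ 1_n) = ρ, then there exist Hermitian positive semidefinite n×n matrices ρ_j with Σ_j Tr(ρ_j) = 1 such that ρ = Σ_j P_j ⊗ₖ ρ_j (ρ is a classical–quantum state). -/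
open Matrix Kronecker
open scoped ComplexOrder

theorem rankOne_aux {m : ℕ} (P : Matrix (Fin m) (Fin m) ℂ) (hH : P.IsHermitian)
    (hI : P * P = P) (hr : P.rank = 1) :
    ∃ v : Fin m → ℂ, P = Matrix.vecMulVec v (star v) ∧ star v ⬝ᵥ v = 1 := by
  unfold Matrix.rank at hr
  obtain ⟨⟨w, hw⟩, hw0, hspan⟩ := finrank_eq_one_iff'.1 hr
  have hw0' : w ≠ 0 := fun h => hw0 (Subtype.ext h)
  have hcol : ∀ j, ∃ c : ℂ, ∀ i, P i j = w i * c := by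
    intro j
    obtain ⟨c, hc⟩ := hspan ⟨P *ᵥ Pi.single j 1, ⟨_, rfl⟩⟩
    refine ⟨c, fun i => ?_⟩
    have := congrFun (congrArg Subtype.val hc) i
    simp at this
    rw [← this, mul_comm]
  choose c hc using hcol
  have hPw : P *ᵥ w = w := by
    obtain ⟨x, rfl⟩ := hw
    simp [hI]
  have hN : 0 < star w ⬝ᵥ w := Matrix.dotProduct_star_self_pos_iff.2 hw0'
  obtain ⟨r, hr0, hrN⟩ : ∃ r : ℝ, 0 < r ∧ (star w ⬝ᵥ w) = (r : ℂ) := by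
    refine ⟨(star w ⬝ᵥ w).re, (Complex.pos_iff.1 hN).1, ?_⟩
    apply Complex.ext
    · simp
    · simpa using (Complex.pos_iff.1 hN).2.symm
  have hc' : ∀ i, w i = star (c i) * r := by
    intro i
    have h1 := congrFun hPw i
    rw [← hrN, ← h1]
    simp only [Matrix.mulVec, dotProduct, Finset.mul_sum]
    refine Finset.sum_congr rfl fun j _ => ?_
    rw [← hH.apply i j, hc]
    simp
    ring
  have hcc : ∀ j, c j = star (w j) / r := by
    intro j
    have hrc : (r : ℂ) ≠ 0 := by exact_mod_cast hr0.ne'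
    rw [hc' j]
    simp [hrc]
  have hs : ((Real.sqrt r : ℝ) : ℂ) * (Real.sqrt r : ℝ) = r := by
    rw [← Complex.ofReal_mul, Real.mul_self_sqrt hr0.le]
  have hs0 : ((Real.sqrt r : ℝ) : ℂ) ≠ 0 := by
    exact_mod_cast (Real.sqrt_pos.2 hr0).ne'
  refine ⟨fun i => w i / (Real.sqrt r : ℝ), ?_, ?_⟩
  · ext i j
    rw [hc, hcc, ← hs]
    simp [Matrix.vecMulVec_apply]
    field_simp
  · have : (star w ⬝ᵥ w) / (r : ℂ) = 1 := by
      rw [hrN]; exact div_self (by exact_mod_cast hr0.ne')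
    rw [← this, ← hs]
    simp only [dotProduct, Finset.sum_div]
    refine Finset.sum_congr rfl fun j _ => ?_
    simp
    field_simp

theorem sandwich_aux {m n : ℕ} (ρ : Matrix (Fin m × Fin n) (Fin m × Fin n) ℂ)
    (hρ : ρ.PosSemidef) (v : Fin m → ℂ) :
    ∃ σ : Matrix (Fin n) (Fin n) ℂ, σ.PosSemidef ∧
      (Matrix.vecMulVec v (star v) ⊗ₖ (1 : Matrix (Fin n) (Fin n) ℂ)) * ρ *
      (Matrix.vecMulVec v (star v) ⊗ₖ (1 : Matrix (Fin n) (Fin n) ℂ)) =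
      Matrix.vecMulVec v (star v) ⊗ₖ σ := by
  let V : Matrix (Fin m × Fin n) (Fin n) ℂ :=
    Matrix.of fun a c => v a.1 * (1 : Matrix (Fin n) (Fin n) ℂ) a.2 c
  have hV : Matrix.vecMulVec v (star v) ⊗ₖ (1 : Matrix (Fin n) (Fin n) ℂ) = V * Vᴴ := by
    ext ⟨a, b⟩ ⟨c, d⟩
    simp [V, Matrix.mul_apply, Matrix.vecMulVec_apply, Matrix.one_apply, eq_comm]
    split_ifs <;> simp
  have hV2 : ∀ σ : Matrix (Fin n) (Fin n) ℂ,
      V * σ * Vᴴ = Matrix.vecMulVec v (star v) ⊗ₖ σ := by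
    intro σ
    ext ⟨a, b⟩ ⟨c, d⟩
    simp [V, Matrix.mul_apply, Matrix.vecMulVec_apply, Matrix.one_apply, apply_ite (starRingEnd ℂ)]
    ring
  refine ⟨Vᴴ * ρ * V, hρ.conjTranspose_mul_mul_same V, ?_⟩
  rw [hV, ← hV2]
  simp only [Matrix.mul_assoc]

/-- A bipartite state invariant under dephasing of the first factor in a complete rank-one
projective family is a classical–quantum state. -/
theorem dephasing_invariant_is_classical_quantum {m n : ℕ}
    (ρ : Matrix (Fin m × Fin n) (Fin m × Fin n) ℂ)
    (hρ : IsDensityMatrix ρ)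
    (P : Fin m → Matrix (Fin m) (Fin m) ℂ)
    (hP : IsRankOneProjFamily P)
    (hdeph : ∑ j, (P j ⊗ₖ (1 : Matrix (Fin n) (Fin n) ℂ)) * ρ *
      (P j ⊗ₖ (1 : Matrix (Fin n) (Fin n) ℂ)) = ρ) :
    ∃ σ : Fin m → Matrix (Fin n) (Fin n) ℂ,
      (∀ j, (σ j).PosSemidef) ∧
      (∑ j, (σ j).trace) = 1 ∧
      ρ = ∑ j, P j ⊗ₖ σ j := by
  obtain ⟨hH, hI, hr, -⟩ := hP
  choose v hv hv1 using fun j => rankOne_aux (P j) (hH j) (by simpa using hI j j) (hr j)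
  choose σ hσ hσ2 using fun j => sandwich_aux ρ hρ.1 (v j)
  have key : ρ = ∑ j, P j ⊗ₖ σ j := by
    rw [← hdeph]
    refine Finset.sum_congr rfl fun j _ => ?_
    rw [hv j]
    exact hσ2 j
  refine ⟨σ, hσ, ?_, key⟩
  rw [← hρ.2]
  conv_rhs => rw [key]
  rw [Matrix.trace_sum]
  refine Finset.sum_congr rfl fun j _ => ?_
  rw [Matrix.trace_kronecker, hv j, Matrix.trace_vecMulVec, dotProduct_comm, hv1, one_mul]
end

section
/- Let ρ : ℝ → Matrix (Fin n) (Fin n) ℂ be a differentiable curve of Hermitian matrices such that ρ(0) is positive definite and Tr(ρ'(0)) = 0, and suppose ρ(t) is positive semidefinite with trace 1 for all t in a neighborhood of 0. Let ρ(0) = Σ_i λ_i v_i v_i† be a spectral decomposition of ρ(0) with orthonormal eigenvectors v_i and (positive) eigenvalues λ_i. Then the von Neumann entropy S(t) = S(ρ(t)) is differentiable at t = 0 with S'(0) = −Σ_i log(λ_i) · ⟨v_i, ρ'(0) v_i⟩ = −Tr(ρ'(0) · log ρ(0)), where log ρ(0) = Σ_i log(λ_i) v_i v_i† is the matrix logarithm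 defined by spectral calculus. -/
open Matrix
open scoped ComplexOrder

lemma scal_bd {x a : ℝ} (hx : 0 ≤ x) (ha : 0 < a) :
    0 ≤ x * Real.log x - a * Real.log a - (Real.log a + 1) * (x - a) ∧
    x * Real.log x - a * Real.log a - (Real.log a + 1) * (x - a) ≤ a⁻¹ * (x - a)^2 := by
  rcases hx.eq_or_lt with rfl | hx
  · constructor
    · simp; nlinarith
    · have : a⁻¹ * (0 - a)^2 = a := by field_simp; ring
      rw [this]; simp; nlinarith
  · have h1 := Real.log_le_sub_one_of_pos (div_pos hx ha)
    have h2 := Real.log_le_sub_one_of_pos (div_pos ha hx)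
    rw [Real.log_div hx.ne' ha.ne'] at h1
    rw [Real.log_div ha.ne' hx.ne'] at h2
    have h1' := mul_le_mul_of_nonneg_left h1 hx.le
    have h2' := mul_le_mul_of_nonneg_left h2 hx.le
    have e2 : x * (a / x - 1) = a - x := by field_simp
    have e1 : x * (x / a - 1) = a⁻¹ * (x - a)^2 + (x - a) := by field_simp; ring
    constructor <;> nlinarith

lemma tr_frob {n : ℕ} (E : Matrix (Fin n) (Fin n) ℂ) :
    (Eᴴ * E).trace = ((∑ i, ∑ j, Complex.normSq (E i j) : ℝ) : ℂ) := by
  simp only [Matrix.trace, Matrix.diag, Matrix.mul_apply, Matrix.conjTranspose_apply]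
  rw [Finset.sum_comm]
  push_cast
  refine Finset.sum_congr rfl fun i _ => Finset.sum_congr rfl fun j _ => ?_
  rw [Complex.normSq_eq_conj_mul_self]; rfl

lemma frob_inv {n : ℕ} (E V U : Matrix (Fin n) (Fin n) ℂ) (hV : V * Vᴴ = 1) (hU : U * Uᴴ = 1) :
    ∑ i, ∑ j, Complex.normSq ((Vᴴ * E * U) i j) = ∑ i, ∑ j, Complex.normSq (E i j) := by
  have h : ((Vᴴ * E * U)ᴴ * (Vᴴ * E * U)).trace = (Eᴴ * E).trace := by
    have : (Vᴴ * E * U)ᴴ * (Vᴴ * E * U) = Uᴴ * (Eᴴ * (V * Vᴴ) * E * U) := by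
      simp only [Matrix.conjTranspose_mul, Matrix.conjTranspose_conjTranspose, Matrix.mul_assoc]
    rw [this, hV, Matrix.trace_mul_comm, Matrix.mul_assoc, hU]; simp
  rw [tr_frob, tr_frob] at h
  exact_mod_cast h

lemma row_one {n : ℕ} (W : Matrix (Fin n) (Fin n) ℂ) (h : W * Wᴴ = 1) (i : Fin n) :
    ∑ j, Complex.normSq (W i j) = 1 := by
  have := congrFun (congrFun h i) i
  rw [Matrix.mul_apply] at this
  simp only [Matrix.conjTranspose_apply, Matrix.one_apply_eq, Complex.star_def, Complex.mul_conj] at this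
  exact_mod_cast this

lemma col_one {n : ℕ} (W : Matrix (Fin n) (Fin n) ℂ) (h : Wᴴ * W = 1) (j : Fin n) :
    ∑ i, Complex.normSq (W i j) = 1 := by
  have := congrFun (congrFun h j) j
  rw [Matrix.mul_apply] at this
  simp only [Matrix.conjTranspose_apply, Matrix.one_apply_eq, Complex.star_def,
    ← Complex.normSq_eq_conj_mul_self] at this
  exact_mod_cast this

lemma key {n : ℕ} (B V : Matrix (Fin n) (Fin n) ℂ) (L : Fin n → ℝ) (hL : ∀ i, 0 < L i)
    (hV : V * Vᴴ = 1) (hB : B.PosSemidef) :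
    |(-vNEntropy B) - ∑ i, L i * Real.log (L i)
      - ∑ i, (Real.log (L i) + 1) * (((Vᴴ * B * V) i i).re - L i)| ≤
    (∑ i, (L i)⁻¹) * ∑ i, ∑ j,
      Complex.normSq ((B - V * diagonal (fun i => (L i : ℂ)) * Vᴴ) i j) := by
  have hV' : Vᴴ * V = 1 := mul_eq_one_comm.mp hV
  have hH := hB.isHermitian
  set U : Matrix (Fin n) (Fin n) ℂ := hH.eigenvectorUnitary.1 with hUdef
  set μ := hH.eigenvalues with hμ
  have hμ0 : ∀ j, 0 ≤ μ j := hB.eigenvalues_nonneg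
  have hU : U * Uᴴ = 1 := by
    rw [← Matrix.star_eq_conjTranspose]; exact Unitary.mul_star_self_of_mem hH.eigenvectorUnitary.2
  have hU' : Uᴴ * U = 1 := mul_eq_one_comm.mp hU
  have hBd : B = U * diagonal (fun j => (μ j : ℂ)) * Uᴴ := by
    have := hH.spectral_theorem
    rw [Unitary.conjStarAlgAut_apply] at this
    exact this
  set W := Vᴴ * U with hW
  have hWW : W * Wᴴ = 1 := by
    rw [hW, conjTranspose_mul, conjTranspose_conjTranspose, Matrix.mul_assoc,
      ← Matrix.mul_assoc U, hU, Matrix.one_mul, hV']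
  have hWW' : Wᴴ * W = 1 := mul_eq_one_comm.mp hWW
  have hrow := row_one W hWW
  have hcol := col_one W hWW'
  have hdiag : ∀ i, ((Vᴴ * B * V) i i).re = ∑ j, Complex.normSq (W i j) * μ j := by
    intro i
    have : Vᴴ * B * V = W * diagonal (fun j => (μ j : ℂ)) * Wᴴ := by
      rw [hW, conjTranspose_mul, conjTranspose_conjTranspose]
      conv_lhs => rw [hBd]
      simp only [Matrix.mul_assoc]
    rw [this, Matrix.mul_apply, Complex.re_sum]
    refine Finset.sum_congr rfl fun j _ => ?_
    rw [Matrix.mul_diagonal, conjTranspose_apply, Complex.star_def, mul_right_comm,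
      Complex.mul_conj, ← Complex.ofReal_mul, Complex.ofReal_re]
  have hfr : ∑ i, ∑ j, Complex.normSq (W i j) * (μ j - L i)^2 = ∑ i, ∑ j,
      Complex.normSq ((B - V * diagonal (fun i => (L i : ℂ)) * Vᴴ) i j) := by
    rw [← frob_inv _ V U hV hU]
    have : Vᴴ * (B - V * diagonal (fun i => (L i : ℂ)) * Vᴴ) * U =
        W * diagonal (fun j => (μ j : ℂ)) - diagonal (fun i => (L i : ℂ)) * W := by
      have e1 : Vᴴ * B * U = W * diagonal (fun j => (μ j : ℂ)) := by
        conv_lhs => rw [hBd]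
        rw [Matrix.mul_assoc, Matrix.mul_assoc _ Uᴴ, hU', Matrix.mul_one, ← Matrix.mul_assoc]
      have e2 : Vᴴ * (V * diagonal (fun i => (L i : ℂ)) * Vᴴ) * U
          = diagonal (fun i => (L i : ℂ)) * W := by
        rw [← Matrix.mul_assoc, ← Matrix.mul_assoc, hV', Matrix.one_mul, Matrix.mul_assoc]
      rw [Matrix.mul_sub, Matrix.sub_mul, e1, e2]
    rw [this]
    refine Finset.sum_congr rfl fun i _ => Finset.sum_congr rfl fun j _ => ?_
    rw [Matrix.sub_apply, Matrix.mul_diagonal, Matrix.diagonal_mul]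
    have : W i j * (μ j : ℂ) - (L i : ℂ) * W i j = W i j * ((μ j - L i : ℝ) : ℂ) := by
      push_cast; ring
    rw [this, Complex.normSq_mul, Complex.normSq_ofReal, sq]
  have hS : -vNEntropy B = ∑ i, ∑ j, Complex.normSq (W i j) * (μ j * Real.log (μ j)) := by
    rw [vNEntropy, dif_pos hH, neg_neg, Finset.sum_comm]
    refine Finset.sum_congr rfl fun j _ => ?_
    rw [← Finset.sum_mul, hcol, one_mul]
  have hall : (-vNEntropy B) - ∑ i, L i * Real.log (L i)
      - ∑ i, (Real.log (L i) + 1) * (((Vᴴ * B * V) i i).re - L i) =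
      ∑ i, ∑ j, Complex.normSq (W i j) * (μ j * Real.log (μ j) - L i * Real.log (L i)
        - (Real.log (L i) + 1) * (μ j - L i)) := by
    rw [hS, ← Finset.sum_sub_distrib, ← Finset.sum_sub_distrib]
    refine Finset.sum_congr rfl fun i _ => ?_
    rw [hdiag]
    have e : ∀ j, Complex.normSq (W i j) * (μ j * Real.log (μ j) - L i * Real.log (L i)
        - (Real.log (L i) + 1) * (μ j - L i)) =
        Complex.normSq (W i j) * (μ j * Real.log (μ j)) - (Real.log (L i) + 1) *
        (Complex.normSq (W i j) * μ j) + Complex.normSq (W i j) * L i := fun j => by ring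
    simp only [e, Finset.sum_add_distrib, Finset.sum_sub_distrib, ← Finset.mul_sum,
      ← Finset.sum_mul, hrow]
    ring
  rw [hall, ← hfr, abs_of_nonneg, Finset.mul_sum]
  · refine Finset.sum_le_sum fun i _ => ?_
    rw [Finset.mul_sum]
    refine Finset.sum_le_sum fun j _ => ?_
    have h1 := (scal_bd (hμ0 j) (hL i)).2
    have h2 : (L i)⁻¹ ≤ ∑ i, (L i)⁻¹ :=
      Finset.single_le_sum (f := fun i => (L i)⁻¹) (fun k _ => (inv_pos.2 (hL k)).le)
        (Finset.mem_univ i)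
    have h3 := mul_le_mul_of_nonneg_right h2 (sq_nonneg (μ j - L i))
    calc _ ≤ Complex.normSq (W i j) * ((∑ i, (L i)⁻¹) * (μ j - L i)^2) :=
          mul_le_mul_of_nonneg_left (h1.trans h3) (Complex.normSq_nonneg _)
      _ = _ := by ring
  · exact Finset.sum_nonneg fun i _ => Finset.sum_nonneg fun j _ =>
      mul_nonneg (Complex.normSq_nonneg _) (scal_bd (hμ0 j) (hL i)).1

/-- Derivative of the von Neumann entropy along a differentiable curve of states:
`S'(0) = -∑ᵢ log(λᵢ) ⟨vᵢ, ρ'(0) vᵢ⟩ = -Tr(ρ'(0) log ρ(0))`. -/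
theorem hasDerivAt_vNEntropy {n : ℕ}
    (ρ : ℝ → Matrix (Fin n) (Fin n) ℂ)
    (ρ' : Matrix (Fin n) (Fin n) ℂ)
    (hHerm : ∀ t, (ρ t).IsHermitian)
    (hdiff : ∀ i j, Differentiable ℝ fun t => ρ t i j)
    (hderiv : ∀ i j, HasDerivAt (fun t => ρ t i j) (ρ' i j) 0)
    (hpos : (ρ 0).PosDef)
    (htr' : ρ'.trace = 0)
    (hstates : ∀ᶠ t in nhds (0 : ℝ), (ρ t).PosSemidef ∧ (ρ t).trace = 1)
    (L : Fin n → ℝ) (v : Fin n → Fin n → ℂ)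
    (hLpos : ∀ i, 0 < L i)
    (hortho : ∀ i j, ∑ x, star (v i x) * v j x = if i = j then 1 else 0)
    (hspec : ρ 0 = ∑ i, (L i : ℂ) • Matrix.vecMulVec (v i) (star (v i))) :
    HasDerivAt (fun t => vNEntropy (ρ t))
      (-∑ i, Real.log (L i) * (∑ x, ∑ y, (starRingEnd ℂ) (v i x) * ρ' x y * v i y).re) 0 ∧
    (-∑ i, Real.log (L i) * (∑ x, ∑ y, (starRingEnd ℂ) (v i x) * ρ' x y * v i y).re) =
      -(Matrix.trace (ρ' *
        ∑ i, (Real.log (L i) : ℂ) • Matrix.vecMulVec (v i) (star (v i)))).re := by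
  set V : Matrix (Fin n) (Fin n) ℂ := Matrix.of (fun x i => v i x) with hVdef
  have hV' : Vᴴ * V = 1 := by
    ext i j
    rw [Matrix.mul_apply, Matrix.one_apply]
    exact hortho i j
  have hV : V * Vᴴ = 1 := mul_eq_one_comm.mp hV'
  have hA : ρ 0 = V * diagonal (fun i => (L i : ℂ)) * Vᴴ := by
    rw [hspec]
    ext x y
    rw [Matrix.mul_apply, Matrix.sum_apply]
    refine Finset.sum_congr rfl fun i _ => ?_
    rw [Matrix.mul_diagonal]
    simp [hVdef, Matrix.vecMulVec_apply]
    ring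
  have hq : ∀ (M : Matrix (Fin n) (Fin n) ℂ) i, (Vᴴ * M * V) i i =
      ∑ x, ∑ y, (starRingEnd ℂ) (v i x) * M x y * v i y := by
    intro M i
    rw [Matrix.mul_apply, Finset.sum_comm]
    refine Finset.sum_congr rfl fun y _ => ?_
    rw [Matrix.mul_apply, Finset.sum_mul]
    rfl
  constructor
  · set G : ℝ → ℝ := fun t => ∑ i, (Real.log (L i) + 1) * (((Vᴴ * ρ t * V) i i).re - L i)
      with hG
    set Q : ℝ → ℝ := fun t => (∑ i, (L i)⁻¹) * ∑ i, ∑ j, Complex.normSq ((ρ t - ρ 0) i j)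
      with hQ
    set R : ℝ → ℝ := fun t => (-vNEntropy (ρ t)) - ∑ i, L i * Real.log (L i) - G t with hR
    have hRQ : ∀ᶠ t in nhds (0:ℝ), |R t| ≤ Q t := by
      filter_upwards [hstates] with t ht
      have := key (ρ t) V L hLpos hV ht.1
      rw [← hA] at this
      exact this
    have hQ0 : Q 0 = 0 := by simp [hQ]
    have hR0 : R 0 = 0 := by
      have := hRQ.self_of_nhds
      rw [hQ0] at this
      exact abs_nonpos_iff.mp this
    have hQd : HasDerivAt Q 0 0 := by
      have h1 : ∀ i j, HasDerivAt (fun t => Complex.normSq ((ρ t - ρ 0) i j)) 0 0 := by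
        intro i j
        have h := (hderiv i j).sub_const (ρ 0 i j)
        have := h.norm_sq
        simp only [sub_self, inner_zero_left, mul_zero] at this
        simpa [Complex.normSq_eq_norm_sq] using this
      have h2 := (HasDerivAt.fun_sum (u := Finset.univ) fun i _ =>
        HasDerivAt.fun_sum (u := Finset.univ) fun j _ => h1 i j).const_mul (∑ i, (L i)⁻¹)
      simp only [Finset.sum_const_zero, mul_zero] at h2
      exact h2
    have hRd : HasDerivAt R 0 0 := by
      rw [hasDerivAt_iff_isLittleO] at hQd ⊢
      simp only [hR0, hQ0, sub_zero, smul_zero] at hQd ⊢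
      refine Asymptotics.IsBigO.trans_isLittleO ?_ hQd
      refine Asymptotics.IsBigO.of_bound 1 ?_
      filter_upwards [hRQ] with t ht
      rw [one_mul, Real.norm_eq_abs, Real.norm_eq_abs]
      exact ht.trans (le_abs_self _)
    have hGd : HasDerivAt G (∑ i, (Real.log (L i) + 1) * ((Vᴴ * ρ' * V) i i).re) 0 := by
      refine HasDerivAt.fun_sum fun i _ => ?_
      refine HasDerivAt.const_mul _ (HasDerivAt.sub_const _ ?_)
      have h : HasDerivAt (fun t => (Vᴴ * ρ t * V) i i) ((Vᴴ * ρ' * V) i i) 0 := by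
        simp only [hq]
        exact HasDerivAt.fun_sum fun x _ => HasDerivAt.fun_sum fun y _ =>
          ((hderiv x y).const_mul _).mul_const _
      exact (Complex.reCLM.hasFDerivAt.comp_hasDerivAt (0:ℝ) h)
    have htr : ∑ i, ((Vᴴ * ρ' * V) i i).re = 0 := by
      have : (Vᴴ * ρ' * V).trace = 0 := by
        rw [Matrix.trace_mul_comm, ← Matrix.mul_assoc, hV, Matrix.one_mul, htr']
      have h := congrArg Complex.re this
      simpa [Matrix.trace] using h
    have hfin := ((hRd.add hGd).add_const (∑ i, L i * Real.log (L i))).neg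
    have e1 : (fun t => vNEntropy (ρ t)) = -fun x => (R + G) x + ∑ i, L i * Real.log (L i) := by
      funext t
      simp [hR]
    have e2 : -∑ i, Real.log (L i) * (∑ x, ∑ y, (starRingEnd ℂ) (v i x) * ρ' x y * v i y).re =
        -(0 + ∑ i, (Real.log (L i) + 1) * ((Vᴴ * ρ' * V) i i).re) := by
      simp only [add_mul, one_mul, Finset.sum_add_distrib, htr, zero_add, add_zero]
      simp only [hq]
    rw [e1, e2]
    exact hfin
  · congr 1
    rw [Finset.mul_sum, Matrix.trace_sum, Complex.re_sum]
    refine Finset.sum_congr rfl fun i _ => ?_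
    rw [Matrix.mul_smul, Matrix.trace_smul, smul_eq_mul, Complex.re_ofReal_mul]
    congr 2
    simp only [Matrix.trace, Matrix.diag, Matrix.mul_apply, Matrix.vecMulVec_apply]
    refine Finset.sum_congr rfl fun x _ => Finset.sum_congr rfl fun y _ => ?_
    simp only [Pi.star_apply, Complex.star_def]
    ring
end
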